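/- Let E = ℝⁿ, let 0 ≤ L < 1, and let G : E → E be L-Lipschitz. Then the map H defined by H x = (−2L²/(1 + L²))·x + ((1 − L²)/(1 + L²))·G x is Lipschitz with constant (2L/(1 + L²))·((1 + 2L − L²)/2), and for 0 < L < 1 this constant is strictly less than 2L/(1 + L²). Consequently, if F = id + G then ((1 − L²)/(1 + L²))·F − id is Lipschitz with constant strictly less than 2L/(1 + L²), so every function of the residual formulation class R_L lies in the monotone formulation class M_L. -/

import Mathlib

/-- `R_L ⊆ M_L`: for `L`-Lipschitz `G` with `0 ≤ L < 1`, the map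
`H x = (-2L²/(1+L²)) • x + ((1-L²)/(1+L²)) • G x` is Lipschitz with constant
`(2L/(1+L²)) · ((1+2L-L²)/2)`, this constant is `< 2L/(1+L²)` when `0 < L`,
hence `((1-L²)/(1+L²)) • (id + G) - id` is Lipschitz with that constant and
`F = id + G` lies in the monotone formulation class `M_L`. -/
theorem residual_subset_monotone_formulation
    (n : ℕ) (L : ℝ) (hL0 : 0 ≤ L) (hL1 : L < 1)
    (G : EuclideanSpace ℝ (Fin n) → EuclideanSpace ℝ (Fin n))
    (hG : ∀ x y, ‖G x - G y‖ ≤ L * ‖x - y‖) :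
    (∀ x y, ‖((-2 * L ^ 2 / (1 + L ^ 2)) • x + ((1 - L ^ 2) / (1 + L ^ 2)) • G x) -
          ((-2 * L ^ 2 / (1 + L ^ 2)) • y + ((1 - L ^ 2) / (1 + L ^ 2)) • G y)‖ ≤
        (2 * L / (1 + L ^ 2)) * ((1 + 2 * L - L ^ 2) / 2) * ‖x - y‖) ∧
    (0 < L → (2 * L / (1 + L ^ 2)) * ((1 + 2 * L - L ^ 2) / 2) < 2 * L / (1 + L ^ 2)) ∧
    (∀ x y, ‖(((1 - L ^ 2) / (1 + L ^ 2)) • (x + G x) - x) -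
          (((1 - L ^ 2) / (1 + L ^ 2)) • (y + G y) - y)‖ ≤
        (2 * L / (1 + L ^ 2)) * ((1 + 2 * L - L ^ 2) / 2) * ‖x - y‖) ∧
    (∀ x y, ‖((x + G x) - (y + G y)) - (x - y)‖ ≤
        L * ‖((x + G x) - (y + G y)) + (x - y)‖) := by
  have hp : 0 < 1 + L ^ 2 := by positivity
  have hq : 0 ≤ 1 - L ^ 2 := by nlinarith
  have h1 : ∀ x y, ‖((-2 * L ^ 2 / (1 + L ^ 2)) • x + ((1 - L ^ 2) / (1 + L ^ 2)) • G x) -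
          ((-2 * L ^ 2 / (1 + L ^ 2)) • y + ((1 - L ^ 2) / (1 + L ^ 2)) • G y)‖ ≤
        (2 * L / (1 + L ^ 2)) * ((1 + 2 * L - L ^ 2) / 2) * ‖x - y‖ := by
    intro x y
    have e : ((-2 * L ^ 2 / (1 + L ^ 2)) • x + ((1 - L ^ 2) / (1 + L ^ 2)) • G x) -
          ((-2 * L ^ 2 / (1 + L ^ 2)) • y + ((1 - L ^ 2) / (1 + L ^ 2)) • G y)
        = ((1 - L ^ 2) / (1 + L ^ 2)) • (G x - G y) - (2 * L ^ 2 / (1 + L ^ 2)) • (x - y) := by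
      rw [show -2 * L ^ 2 / (1 + L ^ 2) = -(2 * L ^ 2 / (1 + L ^ 2)) by ring]
      module
    rw [e]
    refine (norm_sub_le _ _).trans ?_
    have ha : 0 ≤ (1 - L ^ 2) / (1 + L ^ 2) := by positivity
    have hb : 0 ≤ 2 * L ^ 2 / (1 + L ^ 2) := by positivity
    rw [norm_smul, norm_smul, Real.norm_of_nonneg ha, Real.norm_of_nonneg hb]
    have := mul_le_mul_of_nonneg_left (hG x y) ha
    refine (add_le_add_left this _).trans (le_of_eq ?_)
    ring
  refine ⟨h1, ?_, ?_, ?_⟩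
  · intro h
    have hc : 0 < 2 * L / (1 + L ^ 2) := by positivity
    have : (1 + 2 * L - L ^ 2) / 2 < 1 := by nlinarith
    nlinarith
  · intro x y
    have hk : (1 - L ^ 2) / (1 + L ^ 2) - 1 = -2 * L ^ 2 / (1 + L ^ 2) := by
      field_simp
      ring
    have := h1 x y
    rw [← hk] at this
    convert this using 2
    module
  · intro x y
    have e1 : ((x + G x) - (y + G y)) - (x - y) = G x - G y := by abel
    have e2 : ((x + G x) - (y + G y)) + (x - y) = (2 : ℝ) • (x - y) + (G x - G y) := by module
    rw [e1, e2]
    have h := hG x y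
    have h2 := norm_sub_le ((2 : ℝ) • (x - y) + (G x - G y)) (G x - G y)
    rw [add_sub_cancel_right, norm_smul, Real.norm_of_nonneg (by norm_num)] at h2
    have h3 : ‖x - y‖ ≤ ‖(2 : ℝ) • (x - y) + (G x - G y)‖ := by
      nlinarith [norm_nonneg (x - y)]
    exact h.trans (mul_le_mul_of_nonneg_left h3 hL0)
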